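/- In ℂ[x,y], define f2 = -(1/24)y^2 - xy + y + (13/12)x^2 - (25/12)x + 1, g2 = (3/8)y^2 - (3/2)xy + (3/2)y + x^2 - 2x + 1, and h2 = (1/8)y^2 - (1/4)xy - (37/32)x^2 + (9/4)x - 1. Let g = f2^3 + g2^2 * h2. Then g is irreducible in ℂ[x,y], and there do not exist polynomials p, q ∈ ℂ[x,y] with total degree of p at most 2 and total degree of q at most 3 such that g = p^3 + q^2. -/

import Mathlib

open MvPolynomial

noncomputable section

def x : MvPolynomial (Fin 2) ℂ := X 0
def y : MvPolynomial (Fin 2) ℂ := X 1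
def c (q : ℚ) : MvPolynomial (Fin 2) ℂ := C (q : ℂ)

def f2 : MvPolynomial (Fin 2) ℂ :=
  - c (1/24) * y ^ 2 - x * y + y + c (13/12) * x ^ 2 - c (25/12) * x + 1

def g2 : MvPolynomial (Fin 2) ℂ :=
  c (3/8) * y ^ 2 - c (3/2) * x * y + c (3/2) * y + x ^ 2 - 2 * x + 1

def h2 : MvPolynomial (Fin 2) ℂ :=
  c (1/8) * y ^ 2 - c (1/4) * x * y - c (37/32) * x ^ 2 + c (9/4) * x - 1

/-- The sextic of semi-torus type with configuration `[A_5 + E_6 + 2A_2]`. -/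
def g : MvPolynomial (Fin 2) ℂ := f2 ^ 3 + g2 ^ 2 * h2

namespace Aux

def dl : Polynomial ℂ := Polynomial.C (13/12) - Polynomial.X - Polynomial.C (1/24) * Polynomial.X ^ 2
def gm : Polynomial ℂ :=
  Polynomial.C (3/8) * Polynomial.X ^ 2 - Polynomial.C (3/2) * Polynomial.X + 1
def k0 : Polynomial ℂ := Polynomial.C (3/32)
def k1 : Polynomial ℂ := - (Polynomial.C (1/16) + Polynomial.C (1/4) * Polynomial.X)
def k2 : Polynomial ℂ :=
  - Polynomial.C (37/32) - Polynomial.C (1/4) * Polynomial.X + Polynomial.C (1/8) * Polynomial.X ^ 2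

lemma exists_t0 : ∃ t0 t1 : ℂ, t0 + t1 = 4 ∧ t0 * t1 = 8/3 ∧ t0 ≠ t1 := by
  obtain ⟨s, hs⟩ := IsAlgClosed.exists_pow_nat_eq (3 : ℂ) (n := 2) (by norm_num)
  refine ⟨2 + 2 * s / 3, 2 - 2 * s / 3, by ring, by linear_combination (-4/9) * hs, ?_⟩
  intro h
  have h0 : s = 0 := by linear_combination (3/4) * h
  rw [h0] at hs
  norm_num at hs

lemma t0_sq {t0 t1 : ℂ} (h1 : t0 + t1 = 4) (h2 : t0 * t1 = 8/3) : t0 ^ 2 = 4 * t0 - 8/3 := by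
  linear_combination t0 * h1 - h2

lemma no_root (v : Polynomial ℂ)
    (hv : (Polynomial.C (1/12) * v + dl) ^ 3 + gm ^ 2 * (k0 * v ^ 2 + k1 * v + k2) = 0) : False := by
  obtain ⟨t0, t1, h1, h2, hne⟩ := exists_t0
  have hsq := t0_sq h1 h2
  have hgm : gm = (Polynomial.X - Polynomial.C t0) *
      (Polynomial.C (3/8) * (Polynomial.X - Polynomial.C t1)) := by
    apply Polynomial.funext
    intro r
    simp [gm]
    linear_combination (3/8) * r * h1 - (3/8) * h2
  have hg0 : gm.eval t0 = 0 := by rw [hgm]; simp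
  have hw0 : (Polynomial.C (1/12) * v + dl).eval t0 = 0 := by
    have := congrArg (Polynomial.eval t0) hv
    simp only [Polynomial.eval_add, Polynomial.eval_mul, Polynomial.eval_pow, hg0] at this
    simp only [Polynomial.eval_add, Polynomial.eval_mul]
    simpa using this
  obtain ⟨w, hw⟩ := Polynomial.dvd_iff_isRoot.mpr hw0
  have hπ : (Polynomial.X - Polynomial.C t0) ≠ 0 := Polynomial.X_sub_C_ne_zero t0
  have key : (Polynomial.X - Polynomial.C t0) * w ^ 3 +
      (Polynomial.C (3/8) * (Polynomial.X - Polynomial.C t1)) ^ 2 * (k0 * v ^ 2 + k1 * v + k2) = 0 := by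
    rw [hw, hgm] at hv
    apply mul_left_cancel₀ (pow_ne_zero 2 hπ)
    rw [mul_zero, ← hv]
    ring
  have := congrArg (Polynomial.eval t0) key
  simp [k0, k1, k2, sub_eq_zero, hne] at this
  simp [dl] at hw0
  have hv0 : v.eval t0 = 14 * t0 - 43/3 := by linear_combination 12 * hw0 + (1/2) * hsq
  rw [hv0] at this
  have h3 : t0 = 126/149 := by linear_combination (6/149) * this - (6/149) * 15 * hsq
  rw [h3] at hsq
  norm_num at hsq

def R : Polynomial (Polynomial ℂ) :=
  (Polynomial.C (Polynomial.C (1/12)) + Polynomial.C dl * Polynomial.X) ^ 3 +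
    Polynomial.X * Polynomial.C gm ^ 2 *
      (Polynomial.C k0 + Polynomial.C k1 * Polynomial.X + Polynomial.C k2 * Polynomial.X ^ 2)

lemma R_eq : R = Polynomial.C (Polynomial.C (1/12) ^ 3)
    + Polynomial.C (3 * Polynomial.C (1/12) ^ 2 * dl + gm ^ 2 * k0) * Polynomial.X
    + Polynomial.C (3 * Polynomial.C (1/12) * dl ^ 2 + gm ^ 2 * k1) * Polynomial.X ^ 2
    + Polynomial.C (dl ^ 3 + gm ^ 2 * k2) * Polynomial.X ^ 3 := by
  simp only [R, map_add, map_mul, map_pow, map_ofNat]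
  ring

lemma C12_unit : IsUnit (Polynomial.C (1/12) : Polynomial ℂ) :=
  Polynomial.isUnit_C.mpr (by norm_num)

lemma R_deg : R.natDegree ≤ 3 := by
  rw [R_eq]; compute_degree

lemma cubic_aux {S : Type*} [CommRing S] [IsDomain S] (r0 r1 r2 r3 : S) (h0 : IsUnit r0)
    (hroot : ∀ v : S, r0 * v ^ 3 + r1 * v ^ 2 + r2 * v + r3 ≠ 0)
    (A B : Polynomial S) (hA : A.natDegree ≤ 1) (hB : B.natDegree ≤ 2)
    (hAB : Polynomial.C r0 + Polynomial.C r1 * Polynomial.X + Polynomial.C r2 * Polynomial.X ^ 2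
      + Polynomial.C r3 * Polynomial.X ^ 3 = A * B) : False := by
  have hA' := Polynomial.eq_X_add_C_of_natDegree_le_one hA
  have hB' := B.as_sum_range_C_mul_X_pow' (n := 3) (by omega)
  simp only [Finset.sum_range_succ, Finset.sum_range_zero] at hB'
  generalize A.coeff 0 = a0 at hA'
  generalize A.coeff 1 = a1 at hA'
  generalize B.coeff 0 = b0 at hB'
  generalize B.coeff 1 = b1 at hB'
  generalize B.coeff 2 = b2 at hB'
  have hAB2 : Polynomial.C r0 + Polynomial.C r1 * Polynomial.X + Polynomial.C r2 * Polynomial.X ^ 2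
      + Polynomial.C r3 * Polynomial.X ^ 3 = Polynomial.C (a0 * b0) +
      Polynomial.C (a0 * b1 + a1 * b0) * Polynomial.X +
      Polynomial.C (a0 * b2 + a1 * b1) * Polynomial.X ^ 2 + Polynomial.C (a1 * b2) * Polynomial.X ^ 3 := by
    rw [hAB, hA', hB']
    simp only [map_add, map_mul]
    ring
  have c0 := congrArg (fun P => Polynomial.coeff P 0) hAB2
  have c1 := congrArg (fun P => Polynomial.coeff P 1) hAB2
  have c2 := congrArg (fun P => Polynomial.coeff P 2) hAB2
  have c3 := congrArg (fun P => Polynomial.coeff P 3) hAB2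
  simp [Polynomial.coeff_X, Polynomial.coeff_C, Polynomial.coeff_X_pow, -map_mul, -map_add] at c0 c1 c2 c3
  rw [c0] at h0
  obtain ⟨i, hi⟩ := (isUnit_of_mul_isUnit_left h0).exists_right_inv
  apply hroot (-(a1 * i))
  rw [c0, c1, c2, c3]
  linear_combination (-(a1 * b2 - a1^2*b1*i + a1^3*b0*i^2)) * hi

lemma R_irr : Irreducible R := by
  have hroot : ∀ v : Polynomial ℂ, Polynomial.C (1/12) ^ 3 * v ^ 3 +
      (3 * Polynomial.C (1/12) ^ 2 * dl + gm ^ 2 * k0) * v ^ 2 +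
      (3 * Polynomial.C (1/12) * dl ^ 2 + gm ^ 2 * k1) * v + (dl ^ 3 + gm ^ 2 * k2) ≠ 0 := by
    intro v hv
    apply no_root v
    rw [← hv]
    ring
  have hne : R ≠ 0 := by
    intro h
    have := congrArg (fun P => Polynomial.coeff P 0) (R_eq.symm.trans h)
    simp [Polynomial.coeff_X, Polynomial.coeff_C, Polynomial.coeff_X_pow, -map_pow] at this
  have deg0 : ∀ A B : Polynomial (Polynomial ℂ), R = A * B → A.natDegree = 0 → IsUnit A := by
    intro A B h hA
    rw [Polynomial.eq_C_of_natDegree_eq_zero hA] at h ⊢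
    have := congrArg (fun P => Polynomial.coeff P 0) (R_eq.symm.trans h)
    simp [Polynomial.coeff_X, Polynomial.coeff_C, Polynomial.coeff_X_pow, -map_pow] at this
    apply Polynomial.isUnit_C.mpr
    refine isUnit_of_mul_isUnit_left (y := B.coeff 0) ?_
    rw [← this]
    exact (Polynomial.isUnit_C.mpr (by norm_num)).pow 3
  constructor
  · intro hu
    obtain ⟨z, -, hz⟩ := Polynomial.isUnit_iff.mp hu
    have := congrArg (fun P => Polynomial.coeff P 3) (R_eq.symm.trans hz.symm)
    simp [Polynomial.coeff_X, Polynomial.coeff_C, Polynomial.coeff_X_pow, -map_pow, -map_mul, -map_add] at this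
    apply hroot 0
    linear_combination this
  · intro A B h
    have hA0 : A ≠ 0 := by rintro rfl; simp at h; exact hne h
    have hB0 : B ≠ 0 := by rintro rfl; simp at h; exact hne h
    have hd := Polynomial.natDegree_mul hA0 hB0
    rw [← h] at hd
    have := R_deg
    by_cases hA : A.natDegree = 0
    · exact Or.inl (deg0 A B h hA)
    by_cases hB : B.natDegree = 0
    · exact Or.inr (deg0 B A (by rw [h, mul_comm]) hB)
    exfalso
    by_cases hA1 : A.natDegree ≤ 1
    · exact cubic_aux _ _ _ _ (C12_unit.pow 3) hroot A B hA1 (by omega) (R_eq.symm.trans h)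
    · exact cubic_aux _ _ _ _ (C12_unit.pow 3) hroot B A (by omega) (by omega)
        (R_eq.symm.trans (h.trans (mul_comm _ _)))

def ψ : MvPolynomial (Fin 2) ℂ →ₐ[ℂ] Polynomial (Polynomial ℂ) :=
  aeval ![1 + Polynomial.X, Polynomial.C Polynomial.X * Polynomial.X]

def ev (t u : ℂ) : Polynomial (Polynomial ℂ) →+* ℂ :=
  (Polynomial.evalRingHom t).comp (Polynomial.evalRingHom (Polynomial.C u))

lemma ev_ψ (t u : ℂ) (p : MvPolynomial (Fin 2) ℂ) :
    ev t u (ψ p) = MvPolynomial.eval ![1 + u, t * u] p := by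
  have : (ev t u).comp (ψ : MvPolynomial (Fin 2) ℂ →+* Polynomial (Polynomial ℂ)) = MvPolynomial.eval ![1 + u, t * u] := by
    apply MvPolynomial.ringHom_ext
    · intro r
      simp [ev, ψ, Polynomial.algebraMap_apply]
    · intro i
      fin_cases i
      · simp [ev, ψ]
      · simp [ev, ψ]; ring
  exact congrArg (fun F => F p) this

lemma bipoly_ext (P Q : Polynomial (Polynomial ℂ)) (h : ∀ t u, ev t u P = ev t u Q) : P = Q := by
  have h1 : ∀ t, P.map (Polynomial.evalRingHom t) = Q.map (Polynomial.evalRingHom t) := by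
    intro t
    apply Polynomial.funext
    intro u
    have e : ∀ S : Polynomial (Polynomial ℂ),
        ev t u S = (S.map (Polynomial.evalRingHom t)).eval u := by
      intro S
      have := Polynomial.eval₂_hom (p := S) (Polynomial.evalRingHom t) (Polynomial.C u)
      simpa [ev, Polynomial.eval_map] using this.symm
    rw [← e, ← e, h]
  ext1 n
  apply Polynomial.funext
  intro t
  simpa using congrArg (fun S => Polynomial.coeff S n) (h1 t)

lemma eval_g (x0 y0 : ℂ) : MvPolynomial.eval ![x0, y0] g =
   (- (1/24) * y0 ^ 2 - x0 * y0 + y0 + (13/12) * x0 ^ 2 - (25/12) * x0 + 1) ^ 3 +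
   ((3/8) * y0 ^ 2 - (3/2) * x0 * y0 + (3/2) * y0 + x0 ^ 2 - 2 * x0 + 1) ^ 2 *
   ((1/8) * y0 ^ 2 - (1/4) * x0 * y0 - (37/32) * x0 ^ 2 + (9/4) * x0 - 1) := by
  simp [g, f2, g2, h2, x, y, c]

lemma ψ_g : ψ g = Polynomial.X ^ 3 * R := by
  apply bipoly_ext
  intro t u
  rw [ev_ψ, eval_g]
  simp [ev, R, dl, gm, k0, k1, k2]
  ring

lemma unit_of (B : MvPolynomial (Fin 2) ℂ) (hB : ψ B ∣ Polynomial.X ^ 3) (hg : B ∣ g) : IsUnit B := by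
  obtain ⟨k, hk, U, hU⟩ := (dvd_prime_pow Polynomial.prime_X _).mp hB
  obtain ⟨z1, hz1, hz1'⟩ := Polynomial.isUnit_iff.mp (U⁻¹).isUnit
  obtain ⟨z, hz, rfl⟩ := Polynomial.isUnit_iff.mp hz1
  have h1 : ψ B = Polynomial.X ^ k * Polynomial.C (Polynomial.C z) := by
    rw [← hU, hz1']; simp
  have h2 : (X 0 - 1) * (B - C z * (X 0 - 1) ^ k) = 0 := by
    apply MvPolynomial.funext
    intro r
    by_cases hr : r 0 = 1
    · simp [hr]
    · have hr' : r 0 - 1 ≠ 0 := sub_ne_zero.mpr hr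
      have := ev_ψ (r 1 / (r 0 - 1)) (r 0 - 1) B
      have e : ![1 + (r 0 - 1), r 1 / (r 0 - 1) * (r 0 - 1)] = r := by
        ext i; fin_cases i
        · simp
        · simp; field_simp
      rw [e, h1] at this
      simp [ev] at this
      simp [← this]
  have hx : (X 0 - 1 : MvPolynomial (Fin 2) ℂ) ≠ 0 := by
    intro h
    have := congrArg (MvPolynomial.eval ![0, 0]) h
    simp at this
  have h3 : B = C z * (X 0 - 1) ^ k := by
    rcases mul_eq_zero.mp h2 with h | h
    · exact absurd h hx
    · exact sub_eq_zero.mp h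
  rcases Nat.eq_zero_or_pos k with rfl | hk0
  · rw [h3]; simpa using hz.map (C : ℂ →+* MvPolynomial (Fin 2) ℂ)
  · exfalso
    obtain ⟨D, hD⟩ := hg
    have := congrArg (MvPolynomial.eval ![1, 1]) hD
    rw [eval_g, h3] at this
    simp [hk0.ne'] at this
    norm_num at this

lemma g_irr : Irreducible g := by
  constructor
  · intro h
    have h1 := (h.map ψ)
    rw [ψ_g] at h1
    exact R_irr.not_isUnit (isUnit_of_mul_isUnit_right h1)
  · intro A B h
    have h1 : ψ A * ψ B = Polynomial.X ^ 3 * R := by rw [← map_mul, ← h, ψ_g]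
    have hR0 := R_irr.ne_zero
    have hd : R ∣ ψ A * ψ B := h1 ▸ dvd_mul_left _ _
    rcases R_irr.prime.dvd_or_dvd hd with ⟨S, hS⟩ | ⟨S, hS⟩
    · right
      refine unit_of B ⟨S, ?_⟩ ⟨A, by rw [h, mul_comm]⟩
      apply mul_right_cancel₀ hR0
      rw [← h1, hS]; ring
    · left
      refine unit_of A ⟨S, ?_⟩ ⟨B, h⟩
      apply mul_right_cancel₀ hR0
      rw [← h1, hS]; ring

lemma expand (n : ℕ) (p : MvPolynomial (Fin 2) ℂ) (hp : p.totalDegree ≤ n) :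
    ∃ k : ℕ → ℕ → ℂ, ∀ r0 r1 : ℂ, MvPolynomial.eval ![r0, r1] p =
      ∑ i ∈ Finset.range (n + 1), ∑ j ∈ Finset.range (n + 1 - i), k i j * (r0 ^ i * r1 ^ j) := by
  let E : ℕ × ℕ → (Fin 2 →₀ ℕ) := fun ij => Finsupp.equivFunOnFinite.symm ![ij.1, ij.2]
  have hE : ∀ d : Fin 2 →₀ ℕ, E (d 0, d 1) = d := by
    intro d
    ext i
    fin_cases i <;> simp [E]
  refine ⟨fun i j => p.coeff (E (i, j)), fun r0 r1 => ?_⟩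
  rw [Finset.sum_sigma', MvPolynomial.eval_eq']
  apply Finset.sum_of_injOn (fun d : Fin 2 →₀ ℕ => (⟨d 0, d 1⟩ : (_ : ℕ) × ℕ))
  · intro a _ b _ hab
    simp at hab
    rw [← hE a, ← hE b, hab.1, hab.2]
  · intro d hd
    have h1 := MvPolynomial.le_totalDegree (Finset.mem_coe.mp hd)
    rw [Finsupp.sum_fintype _ _ (fun _ => rfl), Fin.sum_univ_two] at h1
    simp
    omega
  · rintro ⟨i, j⟩ _ hn
    have : E (i, j) ∉ p.support := by
      intro hm
      exact hn ⟨E (i, j), hm, by simp [E]⟩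
    simp [MvPolynomial.notMem_support_iff.mp this]
  · intro d _
    simp only [hE, Fin.prod_univ_two]
    simp

lemma expand2 (p : MvPolynomial (Fin 2) ℂ) (hp : p.totalDegree ≤ 2) :
    ∃ a b c d e f : ℂ, ∀ t u : ℂ, MvPolynomial.eval ![1 + u, t * u] p =
      a + (b + c * t) * u + (d + e * t + f * t ^ 2) * u ^ 2 := by
  obtain ⟨k, hk⟩ := expand 2 p hp
  refine ⟨k 0 0 + k 1 0 + k 2 0, k 1 0 + 2 * k 2 0, k 0 1 + k 1 1, k 2 0, k 1 1, k 0 2, ?_⟩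
  intro t u
  rw [hk]
  simp [Finset.sum_range_succ]
  ring

lemma expand3 (p : MvPolynomial (Fin 2) ℂ) (hp : p.totalDegree ≤ 3) :
    ∃ a b c d e f : ℂ, ∃ q3 : ℂ → ℂ, ∀ t u : ℂ, MvPolynomial.eval ![1 + u, t * u] p =
      a + (b + c * t) * u + (d + e * t + f * t ^ 2) * u ^ 2 + q3 t * u ^ 3 := by
  obtain ⟨k, hk⟩ := expand 3 p hp
  refine ⟨k 0 0 + k 1 0 + k 2 0 + k 3 0, k 1 0 + 2 * k 2 0 + 3 * k 3 0, k 0 1 + k 1 1 + k 2 1,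
    k 2 0 + 3 * k 3 0, k 1 1 + 2 * k 2 1, k 0 2 + k 1 2,
    fun t => k 3 0 + k 2 1 * t + k 1 2 * t ^ 2 + k 0 3 * t ^ 3, ?_⟩
  intro t u
  rw [hk]
  simp [Finset.sum_range_succ]
  ring

lemma coeffs6 (c0 c1 c2 c3 c4 c5 c6 : ℂ)
    (h : ∀ u : ℂ, c0 + c1 * u + c2 * u ^ 2 + c3 * u ^ 3 + c4 * u ^ 4 + c5 * u ^ 5 + c6 * u ^ 6 = 0) :
    c0 = 0 ∧ c1 = 0 ∧ c2 = 0 ∧ c3 = 0 ∧ c4 = 0 ∧ c5 = 0 ∧ c6 = 0 := by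
  have e0 := h 0
  have e1 := h 1
  have e2 := h (-1)
  have e3 := h 2
  have e4 := h (-2)
  have e5 := h 3
  have e6 := h (-3)
  have z0 : c0 = 0 := by linear_combination e0
  have o1 : c1 + c3 + c5 = 0 := by linear_combination (e1 - e2) / 2
  have o2 : c1 + 4 * c3 + 16 * c5 = 0 := by linear_combination (e3 - e4) / 4
  have o3 : c1 + 9 * c3 + 81 * c5 = 0 := by linear_combination (e5 - e6) / 6
  have p1 : c2 + c4 + c6 = 0 := by linear_combination (e1 + e2) / 2 - z0
  have p2 : c2 + 4 * c4 + 16 * c6 = 0 := by linear_combination (e3 + e4) / 8 - z0 / 4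
  have p3 : c2 + 9 * c4 + 81 * c6 = 0 := by linear_combination (e5 + e6) / 18 - z0 / 9
  have z5 : c5 = 0 := by linear_combination (3 * (o3 - o1) - 8 * (o2 - o1)) / 120
  have z6 : c6 = 0 := by linear_combination (3 * (p3 - p1) - 8 * (p2 - p1)) / 120
  have z3 : c3 = 0 := by linear_combination (o2 - o1) / 3 - 5 * z5
  have z4 : c4 = 0 := by linear_combination (p2 - p1) / 3 - 5 * z6
  exact ⟨z0, by linear_combination o1 - z3 - z5, by linear_combination p1 - z4 - z6, z3, z4, z5, z6⟩

lemma inner_pt (e α β : ℂ) (h1 : 3 * e + α ^ 2 = 0) (h2 : 3 * e ^ 2 + 2 * α * β = 0)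
    (h3 : e ^ 3 + β ^ 2 = 0) : e = 0 ∧ α = 0 := by
  have he : e = - α ^ 2 / 3 := by linear_combination h1 / 3
  have hb : α ^ 4 / 3 = - 2 * α * β := by rw [he] at h2; linear_combination h2
  have hc : β ^ 2 = α ^ 6 / 27 := by rw [he] at h3; linear_combination h3
  have h8 : α ^ 8 = 0 := by
    linear_combination (-27/1) * ((α ^ 4 / 3 - 2 * α * β) * hb + 4 * α ^ 2 * hc)
  have hα : α = 0 := by simpa using h8
  exact ⟨by rw [he, hα]; simp, hα⟩

lemma quad_mul (t0 t1 a b c : ℂ) (h1 : t0 + t1 = 4) (h2 : t0 * t1 = 8/3) (hne : t0 ≠ t1)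
    (e0 : a + b * t0 + c * t0 ^ 2 = 0) (e1 : a + b * t1 + c * t1 ^ 2 = 0) :
    b = - 4 * c ∧ a = 8/3 * c := by
  have hb : b = -4 * c := by
    apply mul_left_cancel₀ (sub_ne_zero.mpr hne)
    linear_combination e0 - e1 - c * (t0 - t1) * h1
  refine ⟨hb, ?_⟩
  rw [hb] at e0
  linear_combination e0 + c * (h2 - t0 * h1)

def D (t : ℂ) : ℂ := 13/12 - t - 1/24 * t ^ 2
def G (t : ℂ) : ℂ := 3/8 * t ^ 2 - 3/2 * t + 1
def H1 (t : ℂ) : ℂ := -(1/16 + 1/4 * t)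
def H2 (t : ℂ) : ℂ := -37/32 - 1/4 * t + 1/8 * t ^ 2

lemma inner_case (e0 e1 e2 a0 a1 a2 : ℂ) (β : ℂ → ℂ)
    (h1 : ∀ t, 3 * (e0 + e1 * t + e2 * t ^ 2) + (a0 + a1 * t + a2 * t ^ 2) ^ 2 = G t ^ 2 * (27/2))
    (h2 : ∀ t, 3 * (e0 + e1 * t + e2 * t ^ 2) ^ 2 + 2 * (a0 + a1 * t + a2 * t ^ 2) * β t =
      G t ^ 2 * (-27 * D t + 12 * H1 t))
    (h3 : ∀ t, (e0 + e1 * t + e2 * t ^ 2) ^ 3 + β t ^ 2 =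
      G t ^ 2 * (27/2 * D t ^ 2 - 12 * H1 t * D t + H2 t)) : False := by
  obtain ⟨t0, t1, hs, hp, hne⟩ := exists_t0
  have g0 : G t0 = 0 := by simp only [G]; linear_combination (3/8) * t0_sq hs hp
  have g1 : G t1 = 0 := by
    simp only [G]
    linear_combination (3/8) * t0_sq (t0 := t1) (t1 := t0) (by rw [add_comm, hs]) (by rw [mul_comm, hp])
  obtain ⟨x0, y0⟩ := inner_pt _ _ _ (by simpa [g0] using h1 t0) (by simpa [g0] using h2 t0)
    (by simpa [g0] using h3 t0)
  obtain ⟨x1, y1⟩ := inner_pt _ _ _ (by simpa [g1] using h1 t1) (by simpa [g1] using h2 t1)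
    (by simpa [g1] using h3 t1)
  obtain ⟨u1, u2⟩ := quad_mul t0 t1 _ _ _ hs hp hne x0 x1
  obtain ⟨v1, v2⟩ := quad_mul t0 t1 _ _ _ hs hp hne y0 y1
  subst u1 u2 v1 v2
  have k0 := h1 0
  have k1 := h1 1
  have l2 := h2 0
  have l3 := h3 0
  simp only [G, D, H1, H2] at k0 k1 l2 l3
  have he : e2 = 0 := by linear_combination (k0 * (9/64) - 9 * k1) * (8/81)
  rw [he] at k0 l2 l3
  generalize β 0 = b at l2 l3
  have ka : (a2 * (8/3)) ^ 2 = 27/2 := by linear_combination k0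
  have kb : (a2 * (8/3)) * b = -15 := by linear_combination l2 / 2
  have kc : b ^ 2 = 31/2 := by linear_combination l3
  have : (27/2 : ℂ) * (31/2) = 225 := by
    rw [← ka, ← kc]; linear_combination ((a2 * (8/3)) * b - 15) * kb
  norm_num at this

lemma ext_ne (r : ℂ) (S : Polynomial ℂ) (h : ∀ u, u ≠ r → S.eval u = 0) (u : ℂ) : S.eval u = 0 := by
  have h0 : (Polynomial.X - Polynomial.C r) * S = 0 := by
    apply Polynomial.funext
    intro u
    by_cases hu : u = r
    · simp [hu]
    · simp [h u hu]
  rcases mul_eq_zero.mp h0 with h1 | h1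
  · exact absurd h1 (Polynomial.X_sub_C_ne_zero r)
  · simp [h1]

lemma outer_case (δ p0 p1 p2 q0 q1 q2 q3 : ℂ) (hδ : δ ≠ 0) (hp0 : p0 ≠ 0)
    (h : ∀ u : ℂ, u ^ 3 * (1/12 + δ * u) ^ 3 = (p0 + p1 * u + p2 * u ^ 2) ^ 3 +
      (q0 + q1 * u + q2 * u ^ 2 + q3 * u ^ 3) ^ 2) : False := by
  have hq0 : q0 ≠ 0 := by
    intro hq
    have := h 0
    simp [hq] at this
    exact hp0 (by simpa using this.symm)
  let r : ℂ := -1 / (12 * δ)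
  have hr : r ≠ 0 := by simp [r, hδ]
  have hr' : 1/12 = - δ * r := by simp only [r]; field_simp
  by_cases hpr : p0 + p1 * r + p2 * r ^ 2 = 0
  · have hqr : q0 + q1 * r + q2 * r ^ 2 + q3 * r ^ 3 = 0 := by
      have := h r
      rw [hpr, hr'] at this
      simpa using this.symm
    -- division by (u - r)
    have hp : ∀ u, p0 + p1 * u + p2 * u ^ 2 = (u - r) * ((p1 + p2 * r) + p2 * u) := by
      intro u; linear_combination hpr
    have hq : ∀ u, q0 + q1 * u + q2 * u ^ 2 + q3 * u ^ 3 =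
        (u - r) * ((q1 + q2 * r + q3 * r ^ 2) + (q2 + q3 * r) * u + q3 * u ^ 2) := by
      intro u; linear_combination hqr
    have hm0 : p1 + p2 * r ≠ 0 := by
      intro h0
      apply hp0
      have := hp 0
      rw [h0] at this
      simpa using this
    generalize p1 + p2 * r = m0 at *
    generalize p2 = m1 at *
    generalize q1 + q2 * r + q3 * r ^ 2 = n0 at *
    generalize q2 + q3 * r = n1 at *
    generalize q3 = n2 at *
    have h2 : ∀ u, u ≠ r → (u - r) * (δ ^ 3 * u ^ 3 - (m0 + m1 * u) ^ 3) = (n0 + n1 * u + n2 * u ^ 2) ^ 2 := by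
      intro u hu
      apply mul_left_cancel₀ (pow_ne_zero 2 (sub_ne_zero.mpr hu))
      have := h u
      rw [hp, hq, hr'] at this
      linear_combination this
    have h2' : ∀ u, (u - r) * (δ ^ 3 * u ^ 3 - (m0 + m1 * u) ^ 3) = (n0 + n1 * u + n2 * u ^ 2) ^ 2 := by
      intro u
      have := ext_ne r ((.X - .C r) * (.C (δ ^ 3) * .X ^ 3 - (.C m0 + .C m1 * .X) ^ 3) -
        (.C n0 + .C n1 * .X + .C n2 * .X ^ 2) ^ 2) (by
          intro u hu
          simpa [sub_eq_zero] using h2 u hu) u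
      simpa [sub_eq_zero] using this
    have hn : n0 + n1 * r + n2 * r ^ 2 = 0 := by
      have := h2' r
      simpa using this.symm
    have h3 : ∀ u, u ≠ r → (δ ^ 3 * u ^ 3 - (m0 + m1 * u) ^ 3) =
        (u - r) * ((n1 + n2 * r) + n2 * u) ^ 2 := by
      intro u hu
      apply mul_left_cancel₀ (sub_ne_zero.mpr hu)
      have e : n0 + n1 * u + n2 * u ^ 2 = (u - r) * ((n1 + n2 * r) + n2 * u) := by
        linear_combination hn
      rw [h2' u, e]
      ring
    generalize n1 + n2 * r = k0 at *
    generalize n2 = k1 at *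
    have h3' : ∀ u, (δ ^ 3 * u ^ 3 - (m0 + m1 * u) ^ 3) = (u - r) * (k0 + k1 * u) ^ 2 := by
      intro u
      have := ext_ne r ((.C (δ ^ 3) * .X ^ 3 - (.C m0 + .C m1 * .X) ^ 3) -
        (.X - .C r) * (.C k0 + .C k1 * .X) ^ 2) (by
          intro u hu
          simpa [sub_eq_zero] using h3 u hu) u
      simpa [sub_eq_zero] using this
    obtain ⟨c0, c1, c2, c3, -⟩ := coeffs6 (m0 ^ 3 - r * k0 ^ 2)
      (3 * m0 ^ 2 * m1 + k0 ^ 2 - 2 * r * k0 * k1)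
      (3 * m0 * m1 ^ 2 + 2 * k0 * k1 - r * k1 ^ 2) (m1 ^ 3 - δ ^ 3 + k1 ^ 2) 0 0 0 (by
        intro u
        linear_combination -h3' u)
    have hk0 : k0 ≠ 0 := by
      rintro rfl
      apply hm0
      simpa using c0
    by_cases hk1 : k1 = 0
    · subst hk1
      have hm1 : m1 = 0 := by simpa [hm0] using c2
      subst hm1
      apply hk0
      simpa using c1
    · obtain ⟨s, hs⟩ : ∃ s, k0 = - k1 * s := ⟨-k0 / k1, by field_simp⟩
      subst hs
      have d0 : δ ^ 3 * s ^ 3 = (m0 + m1 * s) ^ 3 := by linear_combination h3' s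
      have d1 : δ ^ 3 * s ^ 2 = (m0 + m1 * s) ^ 2 * m1 := by
        linear_combination (-1/3) * c1 - (2/3) * s * c2 - s ^ 2 * c3
      have d2 : δ ^ 3 * s ^ 2 * m0 = 0 := by
        linear_combination (m0 + m1 * s) * d1 - m1 * d0
      have hs0 : s ≠ 0 := by
        rintro rfl
        simp at hk0
      simp [hδ, hs0, hm0] at d2
  · obtain ⟨P, hPd⟩ : ∃ P : Polynomial ℂ, P = .C p0 + .C p1 * .X + .C p2 * .X ^ 2 := ⟨_, rfl⟩
    obtain ⟨Q, hQd⟩ : ∃ Q : Polynomial ℂ, Q = .C q0 + .C q1 * .X + .C q2 * .X ^ 2 + .C q3 * .X ^ 3 :=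
      ⟨_, rfl⟩
    obtain ⟨L, hLd⟩ : ∃ L : Polynomial ℂ, L = .C δ * (.X * (.X - .C r)) := ⟨_, rfl⟩
    have hL : L ^ 3 = P ^ 3 + Q ^ 2 := by
      apply Polynomial.funext
      intro u
      have := h u
      rw [hr'] at this
      simp [hPd, hQd, hLd]
      linear_combination this
    have hL' := congrArg Polynomial.derivative hL
    simp only [Polynomial.derivative_pow, Polynomial.derivative_add] at hL'
    norm_num [show (Polynomial.C 3 : Polynomial ℂ) = 3 from rfl, show (Polynomial.C 2 : Polynomial ℂ) = 2 from rfl] at hL'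
    have hE : L ^ 2 * (2 * L * Q.derivative - 3 * L.derivative * Q) =
        P ^ 2 * (2 * P * Q.derivative - 3 * P.derivative * Q) := by
      linear_combination 2 * Q.derivative * hL - Q * hL'
    have cop1 : IsCoprime (Polynomial.X : Polynomial ℂ) P := by
      refine (Polynomial.irreducible_X.coprime_iff_not_dvd).mpr ?_
      rw [Polynomial.X_dvd_iff, hPd]
      simpa using hp0
    have cop2 : IsCoprime (Polynomial.X - Polynomial.C r : Polynomial ℂ) P := by
      refine ((Polynomial.irreducible_X_sub_C r).coprime_iff_not_dvd).mpr ?_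
      rw [Polynomial.dvd_iff_isRoot, Polynomial.IsRoot, hPd]
      simpa using hpr
    have copL : IsCoprime L P := by
      rw [hLd]
      refine IsCoprime.mul_left ?_ (cop1.mul_left cop2)
      obtain ⟨i, hi⟩ := (Polynomial.isUnit_C.mpr hδ.isUnit).exists_left_inv
      exact ⟨i, 0, by rw [hi]; simp⟩
    have hdvd : L ^ 2 ∣ (2 * P * Q.derivative - 3 * P.derivative * Q) :=
      (copL.pow (m := 2) (n := 2)).dvd_of_dvd_mul_left (hE ▸ dvd_mul_right _ _)
    have hdeg : (2 * P * Q.derivative - 3 * P.derivative * Q).natDegree ≤ 3 := by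
      have : 2 * P * Q.derivative - 3 * P.derivative * Q =
        .C (2 * p0 * q1 - 3 * p1 * q0) + .C (4 * p0 * q2 - p1 * q1 - 6 * p2 * q0) * .X +
        .C (6 * p0 * q3 + p1 * q2 - 4 * p2 * q1) * .X ^ 2 + .C (3 * p1 * q3 - 2 * p2 * q2) * .X ^ 3 := by
        rw [hPd, hQd]
        apply Polynomial.funext
        intro u
        simp
        ring
      rw [this]
      compute_degree
    have hLdeg : (L ^ 2).natDegree = 4 := by
      rw [Polynomial.natDegree_pow, hLd, Polynomial.natDegree_C_mul hδ,
        Polynomial.natDegree_mul Polynomial.X_ne_zero (Polynomial.X_sub_C_ne_zero r)]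
      simp
    have hE0 := Polynomial.eq_zero_of_dvd_of_natDegree_lt hdvd (by omega)
    have hL0 : L ≠ 0 := by
      rintro hz
      rw [hz] at hLdeg
      simp at hLdeg
    rw [hE0, mul_zero] at hE
    have hF : 2 * L * Q.derivative - 3 * L.derivative * Q = 0 := by
      simpa [hL0] using hE
    have := congrArg (Polynomial.eval 0) hF
    simp [hLd, hQd, hδ, hr, hq0] at this

lemma non_torus (p q : MvPolynomial (Fin 2) ℂ) (hp : p.totalDegree ≤ 2) (hq : q.totalDegree ≤ 3)
    (hg : g = p ^ 3 + q ^ 2) : False := by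
  obtain ⟨p0, b, b', d, d', d'', hP⟩ := expand2 p hp
  obtain ⟨q0, n, n', m, m', m'', q3, hQ⟩ := expand3 q hq
  have key : ∀ t u : ℂ, u ^ 3 * (1/12 + D t * u) ^ 3 +
      u ^ 4 * G t ^ 2 * (3/32 + H1 t * u + H2 t * u ^ 2) =
      (p0 + (b + b' * t) * u + (d + d' * t + d'' * t ^ 2) * u ^ 2) ^ 3 +
      (q0 + (n + n' * t) * u + (m + m' * t + m'' * t ^ 2) * u ^ 2 + q3 t * u ^ 3) ^ 2 := by
    intro t u
    rw [← hP, ← hQ, ← map_pow, ← map_pow, ← map_add, ← hg, eval_g]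
    simp only [D, G, H1, H2]
    ring
  by_cases hp0 : p0 = 0
  · subst hp0
    have hq0 : q0 = 0 := by
      have := key 0 0
      simpa using this.symm
    subst hq0
    have hc : ∀ t, _ := fun t => coeffs6 0 0 ((n + n' * t) ^ 2)
      ((b + b' * t) ^ 3 + 2 * (n + n' * t) * (m + m' * t + m'' * t ^ 2) - 1/1728)
      (3 * (b + b' * t) ^ 2 * (d + d' * t + d'' * t ^ 2) + (m + m' * t + m'' * t ^ 2) ^ 2 +
        2 * (n + n' * t) * q3 t - 3/144 * D t - 3/32 * G t ^ 2)
      (3 * (b + b' * t) * (d + d' * t + d'' * t ^ 2) ^ 2 + 2 * (m + m' * t + m'' * t ^ 2) * q3 t -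
        3/12 * D t ^ 2 - G t ^ 2 * H1 t)
      ((d + d' * t + d'' * t ^ 2) ^ 3 + q3 t ^ 2 - D t ^ 3 - G t ^ 2 * H2 t) (by
        intro u
        linear_combination -key t u)
    have hn : ∀ t, n + n' * t = 0 := fun t => by simpa using (hc t).2.2.1
    simp only [hn] at hc
    have c3 : ∀ t, (b + b' * t) ^ 3 = 1/1728 := fun t => by linear_combination (hc t).2.2.2.1
    have hb3 : b ^ 3 = 1/1728 := by linear_combination c3 0
    have hb0 : b ≠ 0 := by
      rintro rfl
      norm_num at hb3
    have hb' : b' = 0 := by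
      have : b * b' ^ 2 = 0 := by linear_combination (c3 1 + c3 (-1) - 2 * c3 0) / 6
      simpa [hb0] using this
    subst hb'
    have c4 := fun t => (hc t).2.2.2.2.1
    have c5 := fun t => (hc t).2.2.2.2.2.1
    have c6 := fun t => (hc t).2.2.2.2.2.2
    refine inner_case (144 * b ^ 2 * d - 13/12) (144 * b ^ 2 * d' + 1) (144 * b ^ 2 * d'' + 1/24)
      (12 * m) (12 * m') (12 * m'') (fun t => q3 t - 12 * D t * (m + m' * t + m'' * t ^ 2)) ?_ ?_ ?_
    · intro t
      have e4 := c4 t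
      simp only [D] at e4 ⊢
      linear_combination 144 * e4
    · intro t
      have hE : 144 * b ^ 2 * d - 13/12 + (144 * b ^ 2 * d' + 1) * t + (144 * b ^ 2 * d'' + 1/24) * t ^ 2
        = 144 * b ^ 2 * (d + d' * t + d'' * t ^ 2) - D t := by simp only [D]; ring
      have e4 := c4 t
      have e5 := c5 t
      rw [hE]
      linear_combination 12 * e5 - 288 * D t * e4 + 3 * 144 ^ 2 * b * (d + d' * t + d'' * t ^ 2) ^ 2 * hb3
    · intro t
      have hE : 144 * b ^ 2 * d - 13/12 + (144 * b ^ 2 * d' + 1) * t + (144 * b ^ 2 * d'' + 1/24) * t ^ 2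
        = 144 * b ^ 2 * (d + d' * t + d'' * t ^ 2) - D t := by simp only [D]; ring
      have e4 := c4 t
      have e5 := c5 t
      have e6 := c6 t
      rw [hE]
      linear_combination e6 - 12 * D t * e5 + 144 * D t ^ 2 * e4 +
        ((d + d' * t + d'' * t ^ 2) ^ 3 * 144 ^ 3 * (b ^ 3 + 1/1728) - 3 * 144 ^ 2 * b * D t * (d + d' * t + d'' * t ^ 2) ^ 2) * hb3
  · obtain ⟨t0, t1, hs, hp, hne⟩ := exists_t0
    have hsq := t0_sq hs hp
    have g0 : G t0 = 0 := by simp only [G]; linear_combination (3/8) * t0_sq hs hp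
    refine outer_case (D t0) p0 (b + b' * t0) (d + d' * t0 + d'' * t0 ^ 2) q0 (n + n' * t0)
      (m + m' * t0 + m'' * t0 ^ 2) (q3 t0) ?_ hp0 ?_
    · intro h0
      simp only [D] at h0
      have h3 : t0 = 43/42 := by linear_combination (-6/7) * h0 - (6/7) * (1/24) * hsq
      rw [h3] at hsq
      norm_num at hsq
    · intro u
      rw [← key t0 u, g0]
      ring

end Aux

/-- `g` is irreducible and of non-torus type. -/
theorem g_irreducible_and_non_torus :
    Irreducible g ∧
      ¬ ∃ p q : MvPolynomial (Fin 2) ℂ,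
        p.totalDegree ≤ 2 ∧ q.totalDegree ≤ 3 ∧ g = p ^ 3 + q ^ 2 := by
  refine ⟨Aux.g_irr, ?_⟩
  rintro ⟨p, q, hp, hq, h⟩
  exact Aux.non_torus p q hp hq h

end
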